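/- Fix integers k ≥ 1, ℓ ≥ 2, p ≥ 0, constants L, c_0 ≥ 0, c > 0, T > 0. Let v_0 : ℝ → ℝ be 1-periodic and belong to the periodic class C^{ℓ+1}_{p,L,c_0}. Consider the RKDG (TVD-RK3 discontinuous Galerkin) scheme on the uniform partition of (0,1) into N cells of size h = 1/N with polynomials of degree ≤ k: v_h^0 := Π_h v_0, and for n ≥ 0 the stages v_h^{n,1}, v_h^{n,2}, v_h^{n+1} ∈ V_h are the unique elements satisfying (v_h^{n,1} − v_h^n, φ) = Δt H(v_h^n, φ), (v_h^{n,2} − (3/4) v_h^n − (1/4) v_h^{n,1}, φ) = (Δt/4) H(v_h^{n,1}, φ), and (v_h^{n+1} − (1/3) v_h^n − (2/3) v_h^{n,2}, φ) = (2Δt/3) H(v_h^{n,2}, φ) for all φ ∈ V_h, where (·,·) is the L²(0,1) inner product and H is the DG bilinear form with upwind flux and periodic identification. Then there exist constants C_0 > 0 and C_1 ≥ 0, depending only on k, ℓ, p, L, c_0, c, T, such that for every N, every Δt with 0 < Δt ≤ C_0 h, and every integer n with nΔt ≤ T, ‖v_h^n − v_0(· − c nΔt)‖_{L²(0,1)}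 ≤ C_1 ( h + h³/Δt² )^{1/2}. In particular, if additionally Δt/h ≥ C̄_0 for a fixed constant C̄_0 > 0, then ‖v_h^n − v_0(· − c nΔt)‖_{L²(0,1)} ≤ C_1' h^{1/2} with C_1' depending additionally on C̄_0. -/

import Mathlib

/-- The set `S + ℤ` of integer translates of points of the finite set `S`. -/
def intTranslates (S : Finset ℝ) : Set ℝ :=
  {x : ℝ | ∃ s ∈ S, ∃ m : ℤ, x = s + (m : ℝ)}

/-- The periodic class `C^{ℓ+1}_{p,L,c₀}`. -/
def PeriodicClass (l p : ℕ) (L c0 : ℝ) (φ : ℝ → ℝ) : Prop :=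
  Function.Periodic φ 1 ∧
  (∀ x y, |φ x - φ y| ≤ L * |x - y|) ∧
  ∃ S : Finset ℝ, (↑S : Set ℝ) ⊆ Set.Ico (0:ℝ) 1 ∧ S.card ≤ p ∧
    ContDiffOn ℝ (l + 1) φ (intTranslates S)ᶜ ∧
    ∀ x ∈ (intTranslates S)ᶜ,
      |iteratedDerivWithin (l + 1) φ (intTranslates S)ᶜ x| ≤ c0

/-- The uniform partition of `(0,1)` into `N` cells: `pt j = j / N`. -/
noncomputable def uniPt (N : ℕ) : ℕ → ℝ := fun j => (j : ℝ) / (N : ℝ)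

/-- All cell polynomials have degree at most `k`. -/
def DegLe (k N : ℕ) (P : ℕ → Polynomial ℝ) : Prop :=
  ∀ j < N, (P j).degree ≤ (k : WithBot ℕ)

/-- The `L²(0,1)` inner product of two piecewise polynomials (given cell by cell). -/
noncomputable def dgInnerP (pt : ℕ → ℝ) (N : ℕ) (P Q : ℕ → Polynomial ℝ) : ℝ :=
  ∑ j ∈ Finset.range N, ∫ x in (pt j)..(pt (j + 1)), (P j).eval x * (Q j).eval x

/-- The `L²(0,1)` inner product of a function with a piecewise polynomial. -/
noncomputable def dgInnerF (pt : ℕ → ℝ) (N : ℕ) (f : ℝ → ℝ) (Q : ℕ → Polynomial ℝ) : ℝ :=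
  ∑ j ∈ Finset.range N, ∫ x in (pt j)..(pt (j + 1)), f x * (Q j).eval x

/-- `P` is the `L²(0,1)`-orthogonal projection of the function `f` onto `V_h`. -/
def IsPolyProj (pt : ℕ → ℝ) (N k : ℕ) (f : ℝ → ℝ) (P : ℕ → Polynomial ℝ) : Prop :=
  DegLe k N P ∧ ∀ Q, DegLe k N Q → dgInnerF pt N f Q = dgInnerP pt N P Q

/-- The upwind DG bilinear form `H(φ, ψ) = Σ_j H_j(φ, ψ)` with periodic traces. -/
noncomputable def dgH (c : ℝ) (pt : ℕ → ℝ) (N : ℕ) (Pφ Pψ : ℕ → Polynomial ℝ) : ℝ :=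
  ∑ j ∈ Finset.range N,
    ((∫ x in (pt j)..(pt (j + 1)),
        c * (Pφ j).eval x * ((Polynomial.derivative (Pψ j)).eval x))
      - c * ((Pφ j).eval (pt (j + 1)) * (Pψ j).eval (pt (j + 1))
          - (if j = 0 then (Pφ (N - 1)).eval (pt N) else (Pφ (j - 1)).eval (pt j))
              * (Pψ j).eval (pt j)))

/-- One step of the TVD-RK3 DG scheme for `v_t + c v_x = 0`: `vnp = G^{RK}_{Δt}(vn)`,
via the two intermediate stages, all relations holding against every test element of
`V_h`. -/
def IsRK3Step (c dt : ℝ) (pt : ℕ → ℝ) (N k : ℕ) (vn vnp : ℕ → Polynomial ℝ) : Prop :=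
  ∃ v1 v2 : ℕ → Polynomial ℝ, DegLe k N v1 ∧ DegLe k N v2 ∧
    (∀ Q, DegLe k N Q →
      dgInnerP pt N (fun j => v1 j - vn j) Q = dt * dgH c pt N vn Q) ∧
    (∀ Q, DegLe k N Q →
      dgInnerP pt N
          (fun j => v2 j - Polynomial.C (3/4 : ℝ) * vn j - Polynomial.C (1/4 : ℝ) * v1 j) Q
        = dt / 4 * dgH c pt N v1 Q) ∧
    (∀ Q, DegLe k N Q →
      dgInnerP pt N
          (fun j => vnp j - Polynomial.C (1/3 : ℝ) * vn j - Polynomial.C (2/3 : ℝ) * v2 j) Q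
        = 2 * dt / 3 * dgH c pt N v2 Q)

/-- The `L²(0,1)` distance between a piecewise polynomial and a function. -/
noncomputable def dgErr (pt : ℕ → ℝ) (N : ℕ) (P : ℕ → Polynomial ℝ) (f : ℝ → ℝ) : ℝ :=
  Real.sqrt (∑ j ∈ Finset.range N, ∫ x in (pt j)..(pt (j + 1)), ((P j).eval x - f x) ^ 2)

open scoped InnerProductSpace in
/-- Strong stability of the third order Runge-Kutta polynomial for a dissipative operator. -/
theorem norm_rk3_le {V : Type*} [NormedAddCommGroup V] [InnerProductSpace ℝ V] (A : V →ₗ[ℝ] V)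
    (hneg : ∀ u, ⟪A u, u⟫_ℝ ≤ 0) (hA : ∀ u, ‖A u‖ ≤ ‖u‖) (u : V) :
    ‖u + A u + (1 / 2 : ℝ) • A (A u) + (1 / 6 : ℝ) • A (A (A u))‖ ≤ ‖u‖ := by
  have h1 := hneg (u + (1 / 2 : ℝ) • A u + (1 / 6 : ℝ) • A (A u))
  have h2 := hneg (A u + A (A u))
  simp only [map_add, map_smul] at h1 h2
  generalize A u = w1 at *
  have h3 := hA (A w1)
  generalize A w1 = w2 at *
  generalize A w2 = w3 at *
  have h4 : -(‖w2‖ * ‖w3‖) ≤ ⟪w2, w3⟫_ℝ := (abs_le.1 (abs_real_inner_le_norm w2 w3)).1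
  have h5 : ‖w2‖ * ‖w3‖ ≤ ‖w2‖ ^ 2 := by nlinarith [norm_nonneg w2]
  have h6 : ‖w3‖ ^ 2 ≤ ‖w2‖ ^ 2 := by gcongr
  rw [← real_inner_self_eq_norm_sq] at h5
  rw [← real_inner_self_eq_norm_sq, ← real_inner_self_eq_norm_sq] at h6
  refine le_of_sq_le_sq ?_ (norm_nonneg _)
  rw [← real_inner_self_eq_norm_sq, ← real_inner_self_eq_norm_sq]
  simp only [inner_add_left, inner_add_right, inner_smul_left, inner_smul_right,
    conj_trivial] at *
  rw [real_inner_comm u w1, real_inner_comm u w2, real_inner_comm w1 w2] at h1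
  rw [real_inner_comm w1 w2, real_inner_comm w1 w3, real_inner_comm w2 w3] at h2
  rw [real_inner_comm u w3, real_inner_comm w1 w3, real_inner_comm w2 w3] at h1
  rw [real_inner_comm u w1, real_inner_comm u w2, real_inner_comm u w3,
    real_inner_comm w1 w2, real_inner_comm w1 w3, real_inner_comm w2 w3]
  linarith

open scoped InnerProductSpace in
/-- Lax-Richtmyer estimate for the three-stage scheme in a finite-dimensional inner product
space: the consistency error per step is measured by `ε`. -/
theorem norm_rk3_error_le {V : Type*} [NormedAddCommGroup V] [InnerProductSpace ℝ V]
    [FiniteDimensional ℝ V] (a : V →ₗ[ℝ] V →ₗ[ℝ] ℝ)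
    (hneg : ∀ u, a u u ≤ 0) (hbd : ∀ u w, |a u w| ≤ ‖u‖ * ‖w‖) (v v1 v2 U W : ℕ → V)
    (hv1 : ∀ n φ, ⟪v1 n - v n, φ⟫_ℝ = a (v n) φ)
    (hv2 : ∀ n φ, ⟪v2 n - (3 / 4 : ℝ) • v n - (1 / 4 : ℝ) • v1 n, φ⟫_ℝ = 1 / 4 * a (v1 n) φ)
    (hv : ∀ n φ, ⟪v (n + 1) - (1 / 3 : ℝ) • v n - (2 / 3 : ℝ) • v2 n, φ⟫_ℝ
      = 2 / 3 * a (v2 n) φ)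
    (hW : ∀ n φ, ⟪W n, φ⟫_ℝ = a (U n) φ) {ε : ℝ} (hε : 0 ≤ ε)
    (haW : ∀ n φ, |a (W n) φ| ≤ ε * ‖φ‖) (hU : ∀ n, ‖U (n + 1) - U n - W n‖ ≤ ε) (n : ℕ) :
    ‖v n - U n‖ ≤ ‖v 0 - U 0‖ + n * (2 * ε) := by
  obtain ⟨A, hA⟩ : ∃ A : V →ₗ[ℝ] V, ∀ u φ, ⟪A u, φ⟫_ℝ = a u φ := by
    have : CompleteSpace V := FiniteDimensional.complete ℝ V
    refine ⟨(InnerProductSpace.toDual ℝ V).symm.toLinearEquiv.toLinearMap ∘ₗ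
      (LinearMap.toContinuousLinearMap (𝕜 := ℝ) (E := V) (F' := ℝ)).toLinearMap ∘ₗ a, fun u φ => ?_⟩
    simp
  have ext' : ∀ x y : V, (∀ φ, ⟪x, φ⟫_ℝ = ⟪y, φ⟫_ℝ) → x = y := fun x y h => ext_inner_right ℝ h
  have hA1 : ∀ u, ‖A u‖ ≤ ‖u‖ := fun u => by
    have h1 := (le_abs_self _).trans (hbd u (A u))
    rw [← hA, real_inner_self_eq_norm_sq] at h1
    by_contra! h
    nlinarith [norm_nonneg (A u), norm_nonneg u]
  have e1 : ∀ n, v1 n = v n + A (v n) := fun n => by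
    rw [← sub_eq_iff_eq_add']
    exact ext' _ _ fun φ => by rw [hv1, hA]
  have e2 : ∀ n, v2 n = (3 / 4 : ℝ) • v n + (1 / 4 : ℝ) • v1 n + (1 / 4 : ℝ) • A (v1 n) :=
    fun n => by
    rw [← sub_eq_iff_eq_add', ← sub_sub]
    exact ext' _ _ fun φ => by rw [hv2, inner_smul_left, hA]; simp
  have e3 : ∀ n, v (n + 1) = (1 / 3 : ℝ) • v n + (2 / 3 : ℝ) • v2 n + (2 / 3 : ℝ) • A (v2 n) :=
    fun n => by
    rw [← sub_eq_iff_eq_add', ← sub_sub]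
    exact ext' _ _ fun φ => by rw [hv, inner_smul_left, hA]; simp
  have eW : ∀ n, W n = A (U n) := fun n => ext' _ _ fun φ => by rw [hW, hA]
  have hAW : ∀ n, ‖A (W n)‖ ≤ ε := fun n => by
    have h1 := (le_abs_self _).trans (haW n (A (W n)))
    rw [← hA, real_inner_self_eq_norm_sq] at h1
    by_contra! h
    nlinarith
  induction n with
  | zero => simp
  | succ n ih =>
    have key : v (n + 1) - U (n + 1) = (v n - U n + A (v n - U n)
        + (1 / 2 : ℝ) • A (A (v n - U n)) + (1 / 6 : ℝ) • A (A (A (v n - U n))))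
        + ((1 / 2 : ℝ) • A (W n) + (1 / 6 : ℝ) • A (A (W n)) - (U (n + 1) - U n - W n)) := by
      rw [e3, e2, e1, eW]
      simp only [map_add, map_sub, map_smul]
      module
    have h1 := norm_rk3_le A (fun u => (hA u u).trans_le (hneg u)) hA1 (v n - U n)
    have h2 : ‖(1 / 2 : ℝ) • A (W n)‖ ≤ 1 / 2 * ε := by
      rw [norm_smul]; norm_num; linarith [hAW n]
    have h3 : ‖(1 / 6 : ℝ) • A (A (W n))‖ ≤ 1 / 6 * ε := by
      rw [norm_smul]; norm_num; linarith [hAW n, hA1 (A (W n))]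
    rw [key]
    refine (norm_add_le _ _).trans ?_
    have h4 := norm_sub_le ((1 / 2 : ℝ) • A (W n) + (1 / 6 : ℝ) • A (A (W n)))
      (U (n + 1) - U n - W n)
    have h5 := norm_add_le ((1 / 2 : ℝ) • A (W n)) ((1 / 6 : ℝ) • A (A (W n)))
    push_cast
    linarith [hU n]

/-- The inner product core defined by a positive definite symmetric bilinear form. -/
@[reducible]
def innerCoreOfPosDef {V : Type*} [AddCommGroup V] [Module ℝ V] (B : V →ₗ[ℝ] V →ₗ[ℝ] ℝ)
    (hsymm : ∀ u w, B u w = B w u) (hpos : ∀ u, u ≠ 0 → 0 < B u u) :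
    InnerProductSpace.Core ℝ V where
  inner u w := B u w
  conj_inner_symm u w := by simp [hsymm u w]
  re_inner_nonneg u := by
    by_cases h : u = 0
    · simp [h]
    · simpa using (hpos u h).le
  add_left := by simp
  smul_left := by simp
  definite u h := by
    by_contra h'
    exact (hpos u h').ne' h

theorem rk3_error_le {V : Type*} [AddCommGroup V] [Module ℝ V]
    [FiniteDimensional ℝ V] (B a : V →ₗ[ℝ] V →ₗ[ℝ] ℝ)
    (hsymm : ∀ u w, B u w = B w u) (hpos : ∀ u, u ≠ 0 → 0 < B u u)
    (hneg : ∀ u, a u u ≤ 0) (hbd : ∀ u w, |a u w| ≤ √(B u u) * √(B w w))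
    (v v1 v2 U W : ℕ → V)
    (hv1 : ∀ n φ, B (v1 n - v n) φ = a (v n) φ)
    (hv2 : ∀ n φ, B (v2 n - (3 / 4 : ℝ) • v n - (1 / 4 : ℝ) • v1 n) φ = 1 / 4 * a (v1 n) φ)
    (hv : ∀ n φ, B (v (n + 1) - (1 / 3 : ℝ) • v n - (2 / 3 : ℝ) • v2 n) φ = 2 / 3 * a (v2 n) φ)
    (hW : ∀ n φ, B (W n) φ = a (U n) φ) {ε : ℝ} (hε : 0 ≤ ε)
    (haW : ∀ n φ, |a (W n) φ| ≤ ε * √(B φ φ))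
    (hU : ∀ n, √(B (U (n + 1) - U n - W n) (U (n + 1) - U n - W n)) ≤ ε) (n : ℕ) :
    √(B (v n - U n) (v n - U n)) ≤ √(B (v 0 - U 0) (v 0 - U 0)) + n * (2 * ε) := by
  let core := innerCoreOfPosDef B hsymm hpos
  let _ : NormedAddCommGroup V := core.toNormedAddCommGroup
  let _ : InnerProductSpace ℝ V := InnerProductSpace.ofCore core.toCore
  exact norm_rk3_error_le a hneg hbd v v1 v2 U W hv1 hv2 hv hW hε haW hU n

theorem exists_form_le {V W : Type*} [AddCommGroup V] [Module ℝ V] [FiniteDimensional ℝ V]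
    [NormedAddCommGroup W] [NormedSpace ℝ W]
    (B : V →ₗ[ℝ] V →ₗ[ℝ] ℝ) (hsymm : ∀ u w, B u w = B w u) (hpos : ∀ u, u ≠ 0 → 0 < B u u)
    (f : V →ₗ[ℝ] W) : ∃ C, 0 ≤ C ∧ ∀ u, ‖f u‖ ^ 2 ≤ C * B u u := by
  let core := innerCoreOfPosDef B hsymm hpos
  let _ : NormedAddCommGroup V := core.toNormedAddCommGroup
  let _ : InnerProductSpace ℝ V := InnerProductSpace.ofCore core.toCore
  refine ⟨‖LinearMap.toContinuousLinearMap f‖ ^ 2, by positivity, fun u => ?_⟩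
  have h := (LinearMap.toContinuousLinearMap f).le_opNorm u
  have h2 : B u u = ‖u‖ ^ 2 := real_inner_self_eq_norm_sq u
  rw [h2, ← mul_pow]
  exact pow_le_pow_left₀ (norm_nonneg _) h 2

theorem integral_eval_mul_self_pos {p : Polynomial ℝ} (hp : p ≠ 0) {a b : ℝ} (hab : a < b) :
    0 < ∫ x in a..b, p.eval x * p.eval x := by
  obtain ⟨x, hx, hpx⟩ : ∃ x ∈ Set.Icc a b, p.eval x ≠ 0 := by
    by_contra! h
    exact hp (Polynomial.eq_zero_of_infinite_isRoot p
      ((Set.Icc_infinite hab).mono fun x hx => h x hx))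
  refine intervalIntegral.integral_pos hab (by fun_prop) (fun x _ => mul_self_nonneg _)
    ⟨x, hx, mul_self_pos.2 hpx⟩

theorem exists_unit_inverse_estimate (k : ℕ) (f : Polynomial ℝ →ₗ[ℝ] Polynomial ℝ) :
    ∃ K : ℝ, 0 ≤ K ∧ ∀ p : Polynomial ℝ, p.degree ≤ k → ∀ x ∈ Set.Icc (0 : ℝ) 1,
      (f p).eval x ^ 2 ≤ K * ∫ y in (0 : ℝ)..1, p.eval y * p.eval y := by
  have : FiniteDimensional ℝ (Polynomial.degreeLE ℝ k) := by
    rw [Polynomial.degreeLE_eq_span_X_pow]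
    exact FiniteDimensional.span_finset ℝ _
  have hint : ∀ p q : Polynomial ℝ, IntervalIntegrable (fun y => p.eval y * q.eval y)
      MeasureTheory.volume 0 1 := fun p q => (by fun_prop : Continuous _).intervalIntegrable _ _
  let B : Polynomial.degreeLE ℝ k →ₗ[ℝ] Polynomial.degreeLE ℝ k →ₗ[ℝ] ℝ :=
    LinearMap.mk₂ ℝ (fun p q => ∫ y in (0 : ℝ)..1, p.1.eval y * q.1.eval y)
      (fun p p' q => by
        rw [← intervalIntegral.integral_add (hint _ _) (hint _ _)]; simp [add_mul])
      (fun r p q => by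
        rw [smul_eq_mul, ← intervalIntegral.integral_const_mul]; simp [mul_assoc])
      (fun p q q' => by
        rw [← intervalIntegral.integral_add (hint _ _) (hint _ _)]; simp [mul_add])
      (fun r p q => by
        rw [smul_eq_mul, ← intervalIntegral.integral_const_mul]; simp [mul_left_comm])
  obtain ⟨K, hK, h⟩ := exists_form_le B
    (fun u w => intervalIntegral.integral_congr fun x _ => mul_comm _ _)
    (fun u hu => integral_eval_mul_self_pos (by simpa using hu) one_pos)
    ((Polynomial.toContinuousMapOnAlgHom (Set.Icc (0 : ℝ) 1)).toLinearMap ∘ₗ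
      f ∘ₗ (Polynomial.degreeLE ℝ k).subtype)
  refine ⟨K, hK, fun p hp x hx => ?_⟩
  have h1 := h ⟨p, Polynomial.mem_degreeLE.2 hp⟩
  refine le_trans ?_ h1
  rw [← sq_abs]
  gcongr
  exact ContinuousMap.norm_coe_le_norm
    (Polynomial.toContinuousMapOn (f p) (Set.Icc (0 : ℝ) 1)) ⟨x, hx⟩

/-- Inverse estimates for polynomials of degree at most `k` on an interval of length `h`. -/
theorem exists_inverse_estimate (k : ℕ) : ∃ K : ℝ, 0 ≤ K ∧ ∀ h : ℝ, 0 < h → ∀ a : ℝ,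
    ∀ p : Polynomial ℝ, p.degree ≤ k → ∀ x ∈ Set.Icc a (a + h),
      h * p.eval x ^ 2 ≤ K * (∫ y in a..a + h, p.eval y * p.eval y) ∧
      h ^ 3 * p.derivative.eval x ^ 2 ≤ K * ∫ y in a..a + h, p.eval y * p.eval y := by
  obtain ⟨K, hK, H⟩ := exists_unit_inverse_estimate k LinearMap.id
  obtain ⟨K', hK', H'⟩ := exists_unit_inverse_estimate k Polynomial.derivative
  refine ⟨K + K', by positivity, fun h hh a p hp x hx => ?_⟩
  set q := p.comp (Polynomial.C h * Polynomial.X + Polynomial.C a) with hq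
  have hqdeg : q.degree ≤ k := by
    rw [← Polynomial.natDegree_le_iff_degree_le] at hp ⊢
    refine Polynomial.natDegree_comp_le.trans ?_
    calc _ ≤ p.natDegree * 1 := by
          gcongr
          exact Polynomial.natDegree_linear_le
      _ ≤ k := by simpa using hp
  have hx' : (x - a) / h ∈ Set.Icc (0 : ℝ) 1 :=
    ⟨div_nonneg (by linarith [hx.1]) hh.le, (div_le_one hh).2 (by linarith [hx.2])⟩
  have hx0 : h * ((x - a) / h) + a = x := by field_simp; ring
  have hqx : q.eval ((x - a) / h) = p.eval x := by simp [hq, Polynomial.eval_comp, hx0]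
  have hqx' : q.derivative.eval ((x - a) / h) = h * p.derivative.eval x := by
    simp [hq, Polynomial.derivative_comp, Polynomial.eval_comp, hx0]
  have hqi : ∫ y in (0 : ℝ)..1, q.eval y * q.eval y
      = h⁻¹ * ∫ y in a..a + h, p.eval y * p.eval y := by
    have := intervalIntegral.integral_comp_mul_add (a := 0) (b := 1)
      (fun y => p.eval y * p.eval y) hh.ne' a
    simp only [mul_zero, zero_add, mul_one, smul_eq_mul, add_comm h a] at this
    rw [← this]
    simp [hq, Polynomial.eval_comp]
  have h1 := H q hqdeg _ hx'
  have h2 := H' q hqdeg _ hx'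
  rw [LinearMap.id_apply, hqx, hqi] at h1
  rw [hqx', hqi] at h2
  have hI : 0 ≤ ∫ y in a..a + h, p.eval y * p.eval y :=
    intervalIntegral.integral_nonneg (by linarith) fun y _ => mul_self_nonneg _
  constructor
  · calc _ ≤ h * (K * (h⁻¹ * ∫ y in a..a + h, p.eval y * p.eval y)) := by gcongr
      _ = K * ∫ y in a..a + h, p.eval y * p.eval y := by field_simp
      _ ≤ _ := by gcongr; linarith
  · calc _ = h * (h * p.derivative.eval x) ^ 2 := by ring
      _ ≤ h * (K' * (h⁻¹ * ∫ y in a..a + h, p.eval y * p.eval y)) := by gcongr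
      _ = K' * ∫ y in a..a + h, p.eval y * p.eval y := by field_simp
      _ ≤ _ := by gcongr; linarith

/-- The index of the left neighbour of the cell `j` in a periodic mesh of `N` cells. -/
def prevCell (N j : ℕ) : ℕ := if j = 0 then N - 1 else j - 1

theorem prevCell_lt {N j : ℕ} (hj : j < N) : prevCell N j < N := by
  unfold prevCell; split_ifs <;> omega

theorem sum_prevCell (N : ℕ) (f : ℕ → ℝ) :
    ∑ j ∈ Finset.range N, f (prevCell N j) = ∑ j ∈ Finset.range N, f j := by
  cases N with
  | zero => simp
  | succ M =>
    rw [Finset.sum_range_succ', Finset.sum_range_succ]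
    simp [prevCell]

theorem dgH_eq_sum_prevCell (c : ℝ) (pt : ℕ → ℝ) (N : ℕ) (P Q : ℕ → Polynomial ℝ) :
    dgH c pt N P Q = ∑ j ∈ Finset.range N,
      ((∫ x in (pt j)..(pt (j + 1)), c * (P j).eval x * (Q j).derivative.eval x)
        - c * ((P j).eval (pt (j + 1)) * (Q j).eval (pt (j + 1))
          - (P (prevCell N j)).eval (pt (prevCell N j + 1)) * (Q j).eval (pt j))) := by
  refine Finset.sum_congr rfl fun j hj => ?_
  have hj := Finset.mem_range.1 hj
  have : (if j = 0 then (P (N - 1)).eval (pt N) else (P (j - 1)).eval (pt j))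
      = (P (prevCell N j)).eval (pt (prevCell N j + 1)) := by
    unfold prevCell
    split_ifs with h
    · rw [Nat.sub_add_cancel (by omega)]
    · rw [Nat.sub_add_cancel (by omega)]
  rw [this]

theorem dgH_eq_strong (c : ℝ) (pt : ℕ → ℝ) (N : ℕ) (P Q : ℕ → Polynomial ℝ) :
    dgH c pt N P Q = ∑ j ∈ Finset.range N,
      -c * ((∫ x in (pt j)..(pt (j + 1)), (P j).derivative.eval x * (Q j).eval x)
        + ((P j).eval (pt j) - (P (prevCell N j)).eval (pt (prevCell N j + 1)))
          * (Q j).eval (pt j)) := by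
  rw [dgH_eq_sum_prevCell]
  refine Finset.sum_congr rfl fun j _ => ?_
  have := intervalIntegral.integral_mul_deriv_eq_deriv_mul (a := pt j) (b := pt (j + 1))
    (fun x _ => (P j).hasDerivAt x) (fun x _ => (Q j).hasDerivAt x)
    ((P j).derivative.continuous.intervalIntegrable _ _)
    ((Q j).derivative.continuous.intervalIntegrable _ _)
  simp only [mul_assoc, intervalIntegral.integral_const_mul]
  rw [this]
  ring

theorem dgH_self_nonpos {c : ℝ} (hc : 0 ≤ c) (pt : ℕ → ℝ) (N : ℕ) (P : ℕ → Polynomial ℝ) :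
    dgH c pt N P P ≤ 0 := by
  have h1 := dgH_eq_sum_prevCell c pt N P P
  have h2 := dgH_eq_strong c pt N P P
  have h3 := sum_prevCell N fun j => c * (P j).eval (pt (j + 1)) ^ 2
  have h4 : 0 ≤ ∑ j ∈ Finset.range N,
      c * ((P (prevCell N j)).eval (pt (prevCell N j + 1)) - (P j).eval (pt j)) ^ 2 :=
    Finset.sum_nonneg fun j _ => by positivity
  have h5 : dgH c pt N P P + dgH c pt N P P + ∑ j ∈ Finset.range N,
      c * ((P (prevCell N j)).eval (pt (prevCell N j + 1)) - (P j).eval (pt j)) ^ 2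
      = (∑ j ∈ Finset.range N, c * (P (prevCell N j)).eval (pt (prevCell N j + 1)) ^ 2)
        - ∑ j ∈ Finset.range N, c * (P j).eval (pt (j + 1)) ^ 2 := by
    nth_rewrite 1 [h1]
    rw [h2, ← Finset.sum_add_distrib, ← Finset.sum_add_distrib, ← Finset.sum_sub_distrib]
    refine Finset.sum_congr rfl fun j _ => ?_
    have : ∀ x, c * (P j).eval x * (P j).derivative.eval x
        = c * ((P j).derivative.eval x * (P j).eval x) := fun x => by ring
    simp only [this, intervalIntegral.integral_const_mul]
    ring
  linarith

theorem dgInnerP_self_eq_sum_sq {pt : ℕ → ℝ} {h : ℝ} (hh : 0 ≤ h) (hpt : ∀ j, pt (j + 1) = pt j + h)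
    (N : ℕ) (P : ℕ → Polynomial ℝ) :
    dgInnerP pt N P P = ∑ j ∈ Finset.range N,
      √(∫ x in (pt j)..(pt (j + 1)), (P j).eval x * (P j).eval x) ^ 2 := by
  refine Finset.sum_congr rfl fun j _ => (Real.sq_sqrt ?_).symm
  exact intervalIntegral.integral_nonneg (by rw [hpt]; linarith) fun y _ => mul_self_nonneg _

theorem abs_dgH_le {c : ℝ} (hc : 0 ≤ c) {k : ℕ} {K : ℝ} (hK : 0 ≤ K)
    {pt : ℕ → ℝ} {h : ℝ} (hh : 0 < h) (hpt : ∀ j, pt (j + 1) = pt j + h)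
    (hinv : ∀ a : ℝ, ∀ p : Polynomial ℝ, p.degree ≤ k → ∀ x ∈ Set.Icc a (a + h),
      h * p.eval x ^ 2 ≤ K * (∫ y in a..a + h, p.eval y * p.eval y) ∧
      h ^ 3 * p.derivative.eval x ^ 2 ≤ K * ∫ y in a..a + h, p.eval y * p.eval y)
    {N : ℕ} {P Q : ℕ → Polynomial ℝ} (hP : DegLe k N P) (hQ : DegLe k N Q) :
    |dgH c pt N P Q| ≤ 3 * c * K / h * (√(dgInnerP pt N P P) * √(dgInnerP pt N Q Q)) := by
  set ν : (ℕ → Polynomial ℝ) → ℕ → ℝ := fun R j =>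
    √(∫ x in (pt j)..(pt (j + 1)), (R j).eval x * (R j).eval x) with hν
  have hν0 : ∀ R j, 0 ≤ ν R j := fun R j => Real.sqrt_nonneg _
  have hsum : ∀ R, dgInnerP pt N R R = ∑ j ∈ Finset.range N, ν R j ^ 2 := fun R =>
    dgInnerP_self_eq_sum_sq hh.le hpt N R
  have hνsq : ∀ R j, ∫ x in (pt j)..(pt j + h), (R j).eval x * (R j).eval x = ν R j ^ 2 := by
    intro R j
    rw [← hpt]
    refine (Real.sq_sqrt ?_).symm
    exact intervalIntegral.integral_nonneg (by rw [hpt]; linarith) fun y _ => mul_self_nonneg _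
  have hev : ∀ R, DegLe k N R → ∀ j < N, ∀ x ∈ Set.Icc (pt j) (pt j + h),
      |(R j).eval x| ≤ √(K / h) * ν R j ∧
      |(R j).derivative.eval x| ≤ √(K / h) / h * ν R j := by
    intro R hR j hj x hx
    obtain ⟨h1, h2⟩ := hinv _ _ (hR j hj) x hx
    rw [hνsq] at h1 h2
    have hs := Real.sq_sqrt (div_nonneg hK hh.le)
    constructor
    · refine abs_le_of_sq_le_sq ?_ (mul_nonneg (Real.sqrt_nonneg _) (hν0 _ _))
      rw [mul_pow, hs, div_mul_eq_mul_div, le_div_iff₀ hh]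
      linarith
    · refine abs_le_of_sq_le_sq ?_
        (mul_nonneg (div_nonneg (Real.sqrt_nonneg _) hh.le) (hν0 _ _))
      rw [mul_pow, div_pow, hs, div_div, div_mul_eq_mul_div, le_div_iff₀ (by positivity)]
      linarith
  have hsK : √(K / h) * √(K / h) = K / h := Real.mul_self_sqrt (div_nonneg hK hh.le)
  have cell : ∀ j ∈ Finset.range N,
      |(∫ x in (pt j)..(pt (j + 1)), c * (P j).eval x * (Q j).derivative.eval x)
        - c * ((P j).eval (pt (j + 1)) * (Q j).eval (pt (j + 1))
          - (P (prevCell N j)).eval (pt (prevCell N j + 1)) * (Q j).eval (pt j))|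
      ≤ 2 * c * K / h * (ν P j * ν Q j) + c * K / h * (ν P (prevCell N j) * ν Q j) := by
    intro j hj
    have hj := Finset.mem_range.1 hj
    have hj' := prevCell_lt hj
    have hl : pt j ∈ Set.Icc (pt j) (pt j + h) := ⟨le_rfl, by linarith⟩
    have hr : ∀ i, pt (i + 1) ∈ Set.Icc (pt i) (pt i + h) := fun i =>
      ⟨by rw [hpt]; linarith, (hpt i).le⟩
    have e1 : |∫ x in (pt j)..(pt (j + 1)), c * (P j).eval x * (Q j).derivative.eval x|
        ≤ c * K / h * (ν P j * ν Q j) := by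
      have := intervalIntegral.norm_integral_le_of_norm_le_const (a := pt j) (b := pt (j + 1))
        (f := fun x => c * (P j).eval x * (Q j).derivative.eval x)
        (C := c * K / h / h * (ν P j * ν Q j)) ?_
      · rw [hpt, add_sub_cancel_left, abs_of_pos hh] at this
        rw [hpt]
        refine this.trans_eq ?_
        field_simp
      · intro x hx
        rw [Set.uIoc_of_le (by rw [hpt]; linarith), hpt] at hx
        have hx' := Set.Ioc_subset_Icc_self hx
        rw [Real.norm_eq_abs, abs_mul, abs_mul, abs_of_nonneg hc]
        calc _ ≤ c * (√(K / h) * ν P j) * (√(K / h) / h * ν Q j) := by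
              have := (hev P hP j hj x hx').1
              have := (hev Q hQ j hj x hx').2
              have := hν0 P j
              gcongr
          _ = c * (√(K / h) * √(K / h)) / h * (ν P j * ν Q j) := by ring
          _ = _ := by rw [hsK]; ring
    have pr : ∀ i < N, ∀ x ∈ Set.Icc (pt i) (pt i + h), ∀ y ∈ Set.Icc (pt j) (pt j + h),
        |(P i).eval x * (Q j).eval y| ≤ K / h * (ν P i * ν Q j) := by
      intro i hi x hx y hy
      rw [abs_mul]
      calc _ ≤ (√(K / h) * ν P i) * (√(K / h) * ν Q j) := by
            have := (hev P hP i hi x hx).1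
            have := (hev Q hQ j hj y hy).1
            have := hν0 P i
            gcongr
        _ = √(K / h) * √(K / h) * (ν P i * ν Q j) := by ring
        _ = _ := by rw [hsK]
    have e2 := pr j hj _ (hr j) _ (hr j)
    have e3 := pr _ hj' _ (hr _) _ hl
    calc _ ≤ _ := abs_sub _ _
      _ ≤ c * K / h * (ν P j * ν Q j) + c * (K / h * (ν P j * ν Q j)
          + K / h * (ν P (prevCell N j) * ν Q j)) := by
          rw [abs_mul, abs_of_nonneg hc]
          gcongr
          exact (abs_sub _ _).trans (add_le_add e2 e3)
      _ = _ := by ring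
  rw [dgH_eq_sum_prevCell, hsum, hsum]
  refine (Finset.abs_sum_le_sum_abs _ _).trans ((Finset.sum_le_sum cell).trans ?_)
  rw [Finset.sum_add_distrib, ← Finset.mul_sum, ← Finset.mul_sum]
  have c1 := Real.sum_mul_le_sqrt_mul_sqrt (Finset.range N) (ν P) (ν Q)
  have c2 := Real.sum_mul_le_sqrt_mul_sqrt (Finset.range N) (fun j => ν P (prevCell N j)) (ν Q)
  rw [sum_prevCell N (fun j => ν P j ^ 2)] at c2
  have hcK : 0 ≤ c * K / h := by positivity
  have m1 := mul_le_mul_of_nonneg_left c1 hcK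
  have m2 := mul_le_mul_of_nonneg_left c2 hcK
  have r1 : ∀ s : ℝ, 2 * c * K / h * s = 2 * (c * K / h * s) := fun s => by ring
  have r2 : ∀ s : ℝ, 3 * c * K / h * s = 3 * (c * K / h * s) := fun s => by ring
  rw [r1, r2]
  linarith

theorem abs_dgH_le_of_piecewise_const {c : ℝ} (hc : 0 ≤ c) {k : ℕ} {K : ℝ} (hK : 0 ≤ K)
    {pt : ℕ → ℝ} {h : ℝ} (hh : 0 < h) (hpt : ∀ j, pt (j + 1) = pt j + h)
    (hinv : ∀ a : ℝ, ∀ p : Polynomial ℝ, p.degree ≤ k → ∀ x ∈ Set.Icc a (a + h),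
      h * p.eval x ^ 2 ≤ K * (∫ y in a..a + h, p.eval y * p.eval y) ∧
      h ^ 3 * p.derivative.eval x ^ 2 ≤ K * ∫ y in a..a + h, p.eval y * p.eval y)
    {N : ℕ} (hN : h * N = 1) {s : ℕ → ℝ} {J : ℝ} (hJ : 0 ≤ J)
    (hs : ∀ j < N, |s j - s (prevCell N j)| ≤ J) {Q : ℕ → Polynomial ℝ} (hQ : DegLe k N Q) :
    |dgH c pt N (fun j => Polynomial.C (s j)) Q| ≤ c * J * √K / h * √(dgInnerP pt N Q Q) := by
  rw [dgH_eq_strong]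
  have cell : ∀ j ∈ Finset.range N,
      |-c * ((∫ x in (pt j)..(pt (j + 1)),
          (Polynomial.C (s j)).derivative.eval x * (Q j).eval x)
        + ((Polynomial.C (s j)).eval (pt j)
          - (Polynomial.C (s (prevCell N j))).eval (pt (prevCell N j + 1))) * (Q j).eval (pt j))|
      ≤ c * J * √(K / h) *
        (1 * √(∫ x in (pt j)..(pt (j + 1)), (Q j).eval x * (Q j).eval x)) := by
    intro j hj
    have hj := Finset.mem_range.1 hj
    have h1 := (hinv _ _ (hQ j hj) (pt j) ⟨le_rfl, by linarith⟩).1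
    rw [← hpt] at h1
    have h2 : |(Q j).eval (pt j)|
        ≤ √(K / h) * √(∫ x in (pt j)..(pt (j + 1)), (Q j).eval x * (Q j).eval x) := by
      rw [← Real.sqrt_mul (div_nonneg hK hh.le)]
      refine Real.abs_le_sqrt ?_
      rw [div_mul_eq_mul_div, le_div_iff₀ hh]
      linarith
    simp only [Polynomial.derivative_C, Polynomial.eval_zero, zero_mul,
      intervalIntegral.integral_zero, zero_add, Polynomial.eval_C]
    rw [abs_mul, abs_mul, abs_neg, abs_of_nonneg hc]
    calc _ ≤ c * (J * (√(K / h) * √(∫ x in (pt j)..(pt (j + 1)),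
            (Q j).eval x * (Q j).eval x))) := by
          have := hs j hj
          gcongr
      _ = _ := by ring
  refine (Finset.abs_sum_le_sum_abs _ _).trans ((Finset.sum_le_sum cell).trans ?_)
  rw [← Finset.mul_sum]
  have c1 := Real.sum_mul_le_sqrt_mul_sqrt (Finset.range N) (fun _ => 1)
    (fun j => √(∫ x in (pt j)..(pt (j + 1)), (Q j).eval x * (Q j).eval x))
  rw [← dgInnerP_self_eq_sum_sq hh.le hpt] at c1
  simp only [one_pow, Finset.sum_const, Finset.card_range, nsmul_eq_mul, mul_one] at c1
  calc _ ≤ c * J * √(K / h) * (√N * √(dgInnerP pt N Q Q)) := by gcongr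
    _ = c * J * (√(K / h) * √N) * √(dgInnerP pt N Q Q) := by ring
    _ = c * J * (√K / h) * √(dgInnerP pt N Q Q) := by
      congr 2
      rw [← Real.sqrt_mul (div_nonneg hK hh.le), ← Real.sqrt_sq hh.le, ← Real.sqrt_div hK,
        Real.sqrt_sq hh.le]
      congr 1
      have : (N : ℝ) = 1 / h := by field_simp; linarith
      rw [this]
      field_simp
    _ = _ := by ring

theorem dgInnerP_congr {pt : ℕ → ℝ} {N : ℕ} {P P' Q Q' : ℕ → Polynomial ℝ}
    (hP : ∀ j < N, P j = P' j) (hQ : ∀ j < N, Q j = Q' j) :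
    dgInnerP pt N P Q = dgInnerP pt N P' Q' := by
  refine Finset.sum_congr rfl fun j hj => ?_
  rw [hP j (Finset.mem_range.1 hj), hQ j (Finset.mem_range.1 hj)]

theorem dgInnerP_comm (pt : ℕ → ℝ) (N : ℕ) (P Q : ℕ → Polynomial ℝ) :
    dgInnerP pt N P Q = dgInnerP pt N Q P :=
  Finset.sum_congr rfl fun _ _ => intervalIntegral.integral_congr fun _ _ => mul_comm _ _

theorem dgH_congr {c : ℝ} {pt : ℕ → ℝ} {N : ℕ} {P P' Q Q' : ℕ → Polynomial ℝ}
    (hP : ∀ j < N, P j = P' j) (hQ : ∀ j < N, Q j = Q' j) :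
    dgH c pt N P Q = dgH c pt N P' Q' := by
  rw [dgH_eq_strong, dgH_eq_strong]
  refine Finset.sum_congr rfl fun j hj => ?_
  have hj := Finset.mem_range.1 hj
  rw [hP j hj, hQ j hj, hP _ (prevCell_lt hj)]

/-- The space of piecewise polynomials of degree at most `k` on `N` cells, extended by zero. -/
def dgSpace (k N : ℕ) : Submodule ℝ (ℕ → Polynomial ℝ) where
  carrier := {P | DegLe k N P ∧ ∀ j, N ≤ j → P j = 0}
  add_mem' := fun ha hb => ⟨fun j hj => (Polynomial.degree_add_le _ _).trans
    (max_le (ha.1 j hj) (hb.1 j hj)), fun j hj => by simp [ha.2 j hj, hb.2 j hj]⟩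
  zero_mem' := ⟨fun j _ => by simp, fun j _ => rfl⟩
  smul_mem' := fun r P hP => ⟨fun j hj => (Polynomial.degree_smul_le r (P j)).trans (hP.1 j hj),
    fun j hj => by simp [hP.2 j hj]⟩

instance (k N : ℕ) : FiniteDimensional ℝ (dgSpace k N) := by
  let f : dgSpace k N →ₗ[ℝ] (Fin N → Fin (k + 1) → ℝ) :=
    LinearMap.pi fun i => LinearMap.pi fun m =>
      Polynomial.lcoeff ℝ m ∘ₗ LinearMap.proj (i : ℕ) ∘ₗ (dgSpace k N).subtype
  refine Module.Finite.of_injective f ((injective_iff_map_eq_zero f).2 fun u hu => ?_)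
  ext j m
  by_cases hj : j < N
  · by_cases hm : m < k + 1
    · exact congrFun (congrFun hu ⟨j, hj⟩) ⟨m, hm⟩
    · exact Polynomial.coeff_eq_zero_of_degree_lt
        ((u.2.1 j hj).trans_lt (by exact_mod_cast Nat.lt_of_succ_le (not_lt.1 hm)))
  · simp [u.2.2 j (not_lt.1 hj)]

/-- The element of `dgSpace k N` with the given cell polynomials. -/
noncomputable def dgSpace.mk {k N : ℕ} (P : ℕ → Polynomial ℝ) (hP : DegLe k N P) : dgSpace k N :=
  ⟨fun j => if j < N then P j else 0, fun j hj => by simpa [hj] using hP j hj,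
    fun j hj => if_neg (not_lt.2 hj)⟩

theorem dgSpace.mk_apply {k N : ℕ} (P : ℕ → Polynomial ℝ) (hP : DegLe k N P) {j : ℕ} (hj : j < N) :
    (dgSpace.mk P hP).1 j = P j := if_pos hj

/-- The `L²` inner product as a bilinear form on `dgSpace k N`. -/
noncomputable def dgInnerForm (pt : ℕ → ℝ) (k N : ℕ) :
    dgSpace k N →ₗ[ℝ] dgSpace k N →ₗ[ℝ] ℝ :=
  have hint : ∀ (p q : Polynomial ℝ) (a b : ℝ), IntervalIntegrable
      (fun y => p.eval y * q.eval y) MeasureTheory.volume a b :=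
    fun p q a b => (by fun_prop : Continuous _).intervalIntegrable _ _
  LinearMap.mk₂ ℝ (fun P Q => dgInnerP pt N P.1 Q.1)
    (fun P P' Q => by
      unfold dgInnerP
      rw [← Finset.sum_add_distrib]
      refine Finset.sum_congr rfl fun j _ => ?_
      rw [← intervalIntegral.integral_add (hint _ _ _ _) (hint _ _ _ _)]
      simp [add_mul])
    (fun r P Q => by
      unfold dgInnerP
      rw [smul_eq_mul, Finset.mul_sum]
      refine Finset.sum_congr rfl fun j _ => ?_
      rw [← intervalIntegral.integral_const_mul]
      simp [mul_assoc])
    (fun P Q Q' => by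
      unfold dgInnerP
      rw [← Finset.sum_add_distrib]
      refine Finset.sum_congr rfl fun j _ => ?_
      rw [← intervalIntegral.integral_add (hint _ _ _ _) (hint _ _ _ _)]
      simp [mul_add])
    (fun r P Q => by
      unfold dgInnerP
      rw [smul_eq_mul, Finset.mul_sum]
      refine Finset.sum_congr rfl fun j _ => ?_
      rw [← intervalIntegral.integral_const_mul]
      simp [mul_left_comm])

/-- The upwind form as a bilinear form on `dgSpace k N`. -/
noncomputable def dgHForm (c : ℝ) (pt : ℕ → ℝ) (k N : ℕ) :
    dgSpace k N →ₗ[ℝ] dgSpace k N →ₗ[ℝ] ℝ :=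
  have hint : ∀ (p q : Polynomial ℝ) (a b : ℝ), IntervalIntegrable
      (fun y => p.eval y * q.eval y) MeasureTheory.volume a b :=
    fun p q a b => (by fun_prop : Continuous _).intervalIntegrable _ _
  LinearMap.mk₂ ℝ (fun P Q => dgH c pt N P.1 Q.1)
    (fun P P' Q => by
      simp only [dgH_eq_strong]
      rw [← Finset.sum_add_distrib]
      refine Finset.sum_congr rfl fun j _ => ?_
      simp only [Submodule.coe_add, Pi.add_apply, map_add, Polynomial.eval_add, add_mul]
      rw [intervalIntegral.integral_add (hint _ _ _ _) (hint _ _ _ _)]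
      ring)
    (fun r P Q => by
      simp only [dgH_eq_strong]
      rw [smul_eq_mul, Finset.mul_sum]
      refine Finset.sum_congr rfl fun j _ => ?_
      simp only [Submodule.coe_smul, Pi.smul_apply, map_smul, Polynomial.eval_smul, smul_eq_mul,
        mul_assoc, intervalIntegral.integral_const_mul]
      ring)
    (fun P Q Q' => by
      simp only [dgH_eq_strong]
      rw [← Finset.sum_add_distrib]
      refine Finset.sum_congr rfl fun j _ => ?_
      simp only [Submodule.coe_add, Pi.add_apply, Polynomial.eval_add, mul_add]
      rw [intervalIntegral.integral_add (hint _ _ _ _) (hint _ _ _ _)]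
      ring)
    (fun r P Q => by
      simp only [dgH_eq_strong]
      rw [smul_eq_mul, Finset.mul_sum]
      refine Finset.sum_congr rfl fun j _ => ?_
      simp only [Submodule.coe_smul, Pi.smul_apply, Polynomial.eval_smul, smul_eq_mul,
        mul_left_comm _ r, intervalIntegral.integral_const_mul]
      ring)

theorem dgInnerForm_pos {pt : ℕ → ℝ} (hpt : ∀ j, pt j < pt (j + 1)) {k N : ℕ}
    {u : dgSpace k N} (hu : u ≠ 0) : 0 < dgInnerForm pt k N u u := by
  obtain ⟨j, hj⟩ : ∃ j, u.1 j ≠ 0 := by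
    by_contra! h
    exact hu (Subtype.ext (funext h))
  have hjN : j < N := by
    by_contra! h
    exact hj (u.2.2 j h)
  refine Finset.sum_pos' (fun i _ => ?_) ⟨j, Finset.mem_range.2 hjN,
    integral_eval_mul_self_pos hj (hpt j)⟩
  exact intervalIntegral.integral_nonneg (hpt i).le fun y _ => mul_self_nonneg _

/-- Discrete Lax-Richtmyer estimate for the RK3 DG scheme. -/
theorem dg_rk3_error_le {c dt : ℝ} (hc : 0 ≤ c) (hdt : 0 ≤ dt) {k : ℕ} {K : ℝ} (hK : 0 ≤ K)
    {pt : ℕ → ℝ} {h : ℝ} (hh : 0 < h) (hpt : ∀ j, pt (j + 1) = pt j + h)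
    (hinv : ∀ a : ℝ, ∀ p : Polynomial ℝ, p.degree ≤ k → ∀ x ∈ Set.Icc a (a + h),
      h * p.eval x ^ 2 ≤ K * (∫ y in a..a + h, p.eval y * p.eval y) ∧
      h ^ 3 * p.derivative.eval x ^ 2 ≤ K * ∫ y in a..a + h, p.eval y * p.eval y)
    (hcfl : dt * (3 * c * K / h) ≤ 1) {N : ℕ} {v U W : ℕ → ℕ → Polynomial ℝ}
    (hv : ∀ n, DegLe k N (v n)) (hstep : ∀ n, IsRK3Step c dt pt N k (v n) (v (n + 1)))
    (hU : ∀ n, DegLe k N (U n)) (hW : ∀ n, DegLe k N (W n))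
    (hWU : ∀ n Q, DegLe k N Q → dgInnerP pt N (W n) Q = dt * dgH c pt N (U n) Q)
    {ε : ℝ} (hε : 0 ≤ ε)
    (haW : ∀ n Q, DegLe k N Q → |dt * dgH c pt N (W n) Q| ≤ ε * √(dgInnerP pt N Q Q))
    (hτ : ∀ n, √(dgInnerP pt N (U (n + 1) - U n - W n) (U (n + 1) - U n - W n)) ≤ ε) (n : ℕ) :
    √(dgInnerP pt N (v n - U n) (v n - U n))
      ≤ √(dgInnerP pt N (v 0 - U 0) (v 0 - U 0)) + n * (2 * ε) := by
  choose v1 v2 hd1 hd2 h1 h2 h3 using hstep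
  have hsub : ∀ P Q (hP : DegLe k N P) (hQ : DegLe k N Q), ∀ j < N,
      (dgSpace.mk P hP - dgSpace.mk Q hQ).1 j = (P - Q) j := fun P Q hP hQ j hj => by
    simp [dgSpace.mk_apply _ _ hj]
  have main := rk3_error_le (dgInnerForm pt k N) (dt • dgHForm c pt k N)
    (fun u w => dgInnerP_comm pt N u.1 w.1)
    (fun u hu => dgInnerForm_pos (fun j => by rw [hpt]; linarith) hu)
    (fun u => mul_nonpos_of_nonneg_of_nonpos hdt (dgH_self_nonpos hc pt N u.1))
    (fun u w => by
      change |dt * dgH c pt N u.1 w.1| ≤ √(dgInnerP pt N u.1 u.1) * √(dgInnerP pt N w.1 w.1)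
      rw [abs_mul, abs_of_nonneg hdt]
      calc _ ≤ dt * (3 * c * K / h * (√(dgInnerP pt N u.1 u.1) * √(dgInnerP pt N w.1 w.1))) := by
            gcongr
            exact abs_dgH_le hc hK hh hpt hinv u.2.1 w.2.1
        _ = dt * (3 * c * K / h) * (√(dgInnerP pt N u.1 u.1) * √(dgInnerP pt N w.1 w.1)) := by
            ring
        _ ≤ 1 * (√(dgInnerP pt N u.1 u.1) * √(dgInnerP pt N w.1 w.1)) := by gcongr
        _ = _ := one_mul _)
    (fun n => dgSpace.mk _ (hv n)) (fun n => dgSpace.mk _ (hd1 n)) (fun n => dgSpace.mk _ (hd2 n))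
    (fun n => dgSpace.mk _ (hU n)) (fun n => dgSpace.mk _ (hW n))
    (fun n φ => by
      have := h1 n φ.1 φ.2.1
      rw [dgH_congr (fun j hj => (dgSpace.mk_apply _ (hv n) hj).symm) fun _ _ => rfl] at this
      refine Eq.trans (dgInnerP_congr (fun j hj => ?_) fun _ _ => rfl) this
      simp [dgSpace.mk_apply _ _ hj])
    (fun n φ => by
      have := h2 n φ.1 φ.2.1
      rw [dgH_congr (fun j hj => (dgSpace.mk_apply _ (hd1 n) hj).symm) fun _ _ => rfl] at this
      refine Eq.trans (dgInnerP_congr (fun j hj => ?_) fun _ _ => rfl) (this.trans ?_)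
      · simp [dgSpace.mk_apply _ _ hj, Polynomial.smul_eq_C_mul]
      · change _ = 1 / 4 * (dt * dgH c pt N _ _)
        ring)
    (fun n φ => by
      have := h3 n φ.1 φ.2.1
      rw [dgH_congr (fun j hj => (dgSpace.mk_apply _ (hd2 n) hj).symm) fun _ _ => rfl] at this
      refine Eq.trans (dgInnerP_congr (fun j hj => ?_) fun _ _ => rfl) (this.trans ?_)
      · simp [dgSpace.mk_apply _ _ hj, Polynomial.smul_eq_C_mul]
      · change _ = 2 / 3 * (dt * dgH c pt N _ _)
        ring)
    (fun n φ => by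
      have := hWU n φ.1 φ.2.1
      rw [dgH_congr (fun j hj => (dgSpace.mk_apply _ (hU n) hj).symm) fun _ _ => rfl] at this
      exact Eq.trans (dgInnerP_congr (fun j hj => dgSpace.mk_apply _ (hW n) hj)
        fun _ _ => rfl) this)
    hε
    (fun n φ => by
      have := haW n φ.1 φ.2.1
      rwa [dgH_congr (fun j hj => (dgSpace.mk_apply _ (hW n) hj).symm) fun _ _ => rfl] at this)
    (fun n => by
      refine Eq.trans_le (congrArg _ ?_) (hτ n)
      refine dgInnerP_congr (fun j hj => ?_) fun j hj => ?_ <;>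
      simp [dgSpace.mk_apply _ _ hj])
    n
  have e : ∀ n, dgInnerForm pt k N (dgSpace.mk _ (hv n) - dgSpace.mk _ (hU n))
      (dgSpace.mk _ (hv n) - dgSpace.mk _ (hU n)) = dgInnerP pt N (v n - U n) (v n - U n) :=
    fun n => dgInnerP_congr (hsub _ _ _ _) (hsub _ _ _ _)
  rwa [e, e] at main

/-- Steklov averaging of a Lipschitz periodic function. -/
theorem exists_steklov_average {f : ℝ → ℝ} {L δ : ℝ} (hf : Function.Periodic f 1) (hL : 0 ≤ L)
    (hlip : ∀ x y, |f x - f y| ≤ L * |x - y|) (hδ : 0 < δ) :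
    ∃ g D : ℝ → ℝ, Function.Periodic g 1 ∧ Function.Periodic D 1 ∧
      (∀ x, |g x - f x| ≤ L * δ) ∧ ∀ x a, |g (x + a) - g x - a * D x| ≤ 2 * L / δ * a ^ 2 := by
  have hcont : Continuous f := (LipschitzWith.of_dist_le_mul (K := ⟨L, hL⟩) hlip).continuous
  have hint : ∀ a b, IntervalIntegrable f MeasureTheory.volume a b :=
    fun a b => hcont.intervalIntegrable a b
  have hder : ∀ x, HasDerivAt (fun x => δ⁻¹ * ∫ y in x..x + δ, f y) (δ⁻¹ * (f (x + δ) - f x)) x := by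
    intro x
    have h1 : ∀ x, HasDerivAt (fun x => ∫ y in (0 : ℝ)..x, f y) (f x) x := fun x =>
      intervalIntegral.integral_hasDerivAt_right (hint _ _)
        hcont.aestronglyMeasurable.stronglyMeasurableAtFilter hcont.continuousAt
    have h2 := (((h1 (x + δ)).comp_add_const x δ).sub (h1 x)).const_mul δ⁻¹
    refine h2.congr_of_eventuallyEq (Filter.Eventually.of_forall fun z => ?_)
    simp only [Pi.sub_apply]
    rw [intervalIntegral.integral_interval_sub_left (hint _ _) (hint _ _)]
  refine ⟨fun x => δ⁻¹ * ∫ y in x..x + δ, f y, fun x => δ⁻¹ * (f (x + δ) - f x),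
    fun x => ?_, fun x => ?_, fun x => ?_, fun x a => ?_⟩
  · have := intervalIntegral.integral_comp_add_right (a := x) (b := x + δ) f 1
    simp only [hf _] at this
    simp only [add_right_comm x 1 δ, this]
  · simp only [add_right_comm x 1 δ, hf _]
  · have h1 : δ⁻¹ * (∫ y in x..x + δ, f y) - f x = δ⁻¹ * ∫ y in x..x + δ, (f y - f x) := by
      rw [intervalIntegral.integral_sub (hint _ _) (by simp), intervalIntegral.integral_const]
      simp only [add_sub_cancel_left, smul_eq_mul]
      field_simp
    have h2 := intervalIntegral.norm_integral_le_of_norm_le_const (a := x) (b := x + δ)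
      (f := fun y => f y - f x) (C := L * δ) fun y hy => by
        rw [Set.uIoc_of_le (by linarith)] at hy
        refine (hlip y x).trans ?_
        gcongr
        rw [abs_of_pos (by linarith [hy.1])]
        linarith [hy.2]
    rw [add_sub_cancel_left, abs_of_pos hδ, Real.norm_eq_abs] at h2
    simp only [h1, abs_mul, abs_inv, abs_of_pos hδ]
    rwa [inv_mul_le_iff₀ hδ, mul_comm δ]
  · have h1 := Convex.norm_image_sub_le_of_norm_hasDerivWithin_le (𝕜 := ℝ)
      (f := fun z => (δ⁻¹ * ∫ y in z..z + δ, f y) - z * (δ⁻¹ * (f (x + δ) - f x)))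
      (f' := fun z => δ⁻¹ * (f (z + δ) - f z) - 1 * (δ⁻¹ * (f (x + δ) - f x)))
      (s := Set.uIcc x (x + a)) (C := 2 * L / δ * |a|) (x := x) (y := x + a)
      (fun z _ => ((hder z).sub ((hasDerivAt_id z).mul_const _)).hasDerivWithinAt)
      (fun z hz => ?_) (convex_uIcc _ _) Set.left_mem_uIcc Set.right_mem_uIcc
    · rw [Real.norm_eq_abs, Real.norm_eq_abs, add_sub_cancel_left, mul_assoc, abs_mul_abs_self] at h1
      refine le_trans (le_of_eq ?_) (h1.trans_eq (by ring))
      congr 1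
      ring
    · have hz' : |z - x| ≤ |a| := by
        have := Set.abs_sub_left_of_mem_uIcc hz
        rwa [add_sub_cancel_left] at this
      have e1 := hlip (z + δ) (x + δ)
      have e2 := hlip z x
      rw [add_sub_add_right_eq_sub] at e1
      have e3 : δ⁻¹ * (f (z + δ) - f z) - 1 * (δ⁻¹ * (f (x + δ) - f x))
          = δ⁻¹ * ((f (z + δ) - f (x + δ)) - (f z - f x)) := by ring
      rw [e3, norm_mul, norm_inv, Real.norm_eq_abs, Real.norm_eq_abs, abs_of_pos hδ,
        inv_mul_le_iff₀ hδ]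
      calc _ ≤ L * |z - x| + L * |z - x| := (abs_sub _ _).trans (add_le_add e1 e2)
        _ ≤ L * |a| + L * |a| := by gcongr
        _ = _ := by field_simp; ring

/-- The polynomial of degree at most one with values `A` at `a` and `B` at `a + h`. -/
noncomputable def linInterp (a h A B : ℝ) : Polynomial ℝ :=
  Polynomial.C A + Polynomial.C ((B - A) / h) * (Polynomial.X - Polynomial.C a)

theorem linInterp_eval (a h A B x : ℝ) :
    (linInterp a h A B).eval x = A + (B - A) / h * (x - a) := by
  simp [linInterp]

theorem linInterp_eval_left (a h A B : ℝ) : (linInterp a h A B).eval a = A := by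
  simp [linInterp]

theorem linInterp_eval_right {h : ℝ} (hh : h ≠ 0) (a A B : ℝ) :
    (linInterp a h A B).eval (a + h) = B := by
  rw [linInterp_eval]; field_simp; ring

theorem linInterp_derivative (a h A B : ℝ) :
    (linInterp a h A B).derivative = Polynomial.C ((B - A) / h) := by
  simp [linInterp]

theorem linInterp_degree_le (a h A B : ℝ) : (linInterp a h A B).degree ≤ 1 := by
  unfold linInterp
  compute_degree

theorem abs_linInterp_sub_le {a h A B x z η : ℝ} (hh : 0 < h) (hx : x ∈ Set.Icc a (a + h))
    (hA : |A - z| ≤ η) (hB : |B - z| ≤ η) : |(linInterp a h A B).eval x - z| ≤ η := by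
  rw [linInterp_eval]
  set θ := (x - a) / h with hθ
  have h0 : 0 ≤ θ := div_nonneg (by linarith [hx.1]) hh.le
  have h1 : θ ≤ 1 := (div_le_one hh).2 (by linarith [hx.2])
  have e : A + (B - A) / h * (x - a) - z = (1 - θ) * (A - z) + θ * (B - z) := by
    rw [hθ]; ring
  rw [abs_le] at *
  rw [e]
  constructor <;> nlinarith

theorem uniPt_succ (N j : ℕ) : uniPt N (j + 1) = uniPt N j + 1 / (N : ℝ) := by
  unfold uniPt; push_cast; ring

theorem Function.Periodic.uniPt_prevCell {F : ℝ → ℝ} (hF : Function.Periodic F 1) {N : ℕ}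
    (t : ℝ) {j : ℕ} (hj : j < N) :
    F (uniPt N (prevCell N j + 1) - t) = F (uniPt N j - t) := by
  have hN : (N : ℝ) ≠ 0 := by
    have : 0 < N := by omega
    positivity
  unfold prevCell
  split_ifs with h
  · rw [Nat.sub_add_cancel (by omega), h, ← hF (uniPt N 0 - t)]
    congr 1
    simp only [uniPt]
    field_simp
    push_cast
    ring
  · rw [Nat.sub_add_cancel (by omega)]

theorem sum_integral_le_of_le {pt : ℕ → ℝ} {h : ℝ} (hh : 0 < h) (hpt : ∀ j, pt (j + 1) = pt j + h)
    {N : ℕ} (hN : h * N = 1) {F G : ℕ → ℝ → ℝ} (hF : ∀ j, Continuous (F j))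
    (hG : ∀ j, Continuous (G j)) {r s : ℝ}
    (hFG : ∀ j < N, ∀ x ∈ Set.Icc (pt j) (pt j + h), F j x ≤ r * G j x + s) :
    ∑ j ∈ Finset.range N, ∫ x in (pt j)..(pt (j + 1)), F j x
      ≤ r * (∑ j ∈ Finset.range N, ∫ x in (pt j)..(pt (j + 1)), G j x) + s := by
  have hs : s = ∑ _j ∈ Finset.range N, h * s := by
    rw [Finset.sum_const, Finset.card_range, nsmul_eq_mul]
    linear_combination -s * hN
  rw [Finset.mul_sum, hs, ← Finset.sum_add_distrib]
  refine Finset.sum_le_sum fun j hj => ?_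
  have h1 := intervalIntegral.integral_mono_on (a := pt j) (b := pt (j + 1)) (f := F j)
    (g := fun x => r * G j x + s) (μ := MeasureTheory.volume) (by rw [hpt]; linarith)
    ((hF j).intervalIntegrable _ _)
    ((((hG j).const_mul r).add continuous_const).intervalIntegrable _ _)
    (fun x hx => hFG j (Finset.mem_range.1 hj) x (by rwa [hpt] at hx))
  refine h1.trans_eq ?_
  rw [intervalIntegral.integral_add (((hG j).const_mul r).intervalIntegrable _ _) (by simp),
    intervalIntegral.integral_const_mul, intervalIntegral.integral_const, hpt, add_sub_cancel_left,
    smul_eq_mul]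

theorem sqrt_dgInnerP_self_le {pt : ℕ → ℝ} {h : ℝ} (hh : 0 < h)
    (hpt : ∀ j, pt (j + 1) = pt j + h) {N : ℕ} (hN : h * N = 1) {P : ℕ → Polynomial ℝ} {η : ℝ}
    (hη : 0 ≤ η) (hP : ∀ j < N, ∀ x ∈ Set.Icc (pt j) (pt j + h), |(P j).eval x| ≤ η) :
    √(dgInnerP pt N P P) ≤ η := by
  refine Real.sqrt_le_iff.2 ⟨hη, ?_⟩
  have := sum_integral_le_of_le hh hpt hN (F := fun j x => (P j).eval x * (P j).eval x)
    (G := fun _ _ => 0) (r := 0) (s := η ^ 2) (fun j => by fun_prop) (fun j => continuous_const)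
    (fun j hj x hx => by
      have := hP j hj x hx
      rw [← abs_mul_abs_self]
      nlinarith [abs_nonneg ((P j).eval x)])
  simpa [dgInnerP] using this

theorem dgErr_le {pt : ℕ → ℝ} {h : ℝ} (hh : 0 < h) (hpt : ∀ j, pt (j + 1) = pt j + h)
    {N : ℕ} (hN : h * N = 1) {P U : ℕ → Polynomial ℝ} {f : ℝ → ℝ} (hf : Continuous f) {η : ℝ}
    (hη : 0 ≤ η) (hU : ∀ j < N, ∀ x ∈ Set.Icc (pt j) (pt j + h), |(U j).eval x - f x| ≤ η) :
    dgErr pt N P f ≤ 2 * √(dgInnerP pt N (P - U) (P - U)) + 2 * η := by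
  set R := √(dgInnerP pt N (P - U) (P - U)) with hR
  have hR0 : 0 ≤ R := Real.sqrt_nonneg _
  have hI : 0 ≤ dgInnerP pt N (P - U) (P - U) := Finset.sum_nonneg fun j _ =>
    intervalIntegral.integral_nonneg (by rw [hpt]; linarith) fun y _ => mul_self_nonneg _
  refine Real.sqrt_le_iff.2 ⟨by positivity, ?_⟩
  have := sum_integral_le_of_le hh hpt hN (F := fun j x => ((P j).eval x - f x) ^ 2)
    (G := fun j x => ((P - U) j).eval x * ((P - U) j).eval x) (r := 2) (s := 2 * η ^ 2)
    (fun j => by fun_prop) (fun j => by fun_prop)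
    (fun j hj x hx => by
      have h1 := sq_le_sq.2 ((hU j hj x hx).trans (le_abs_self η))
      rw [Pi.sub_apply, Polynomial.eval_sub]
      nlinarith [sq_nonneg ((P j).eval x - (U j).eval x - ((U j).eval x - f x))])
  refine this.trans ?_
  have h2 : dgInnerP pt N (P - U) (P - U) = R ^ 2 := (Real.sq_sqrt hI).symm
  unfold dgInnerP at h2
  rw [h2]
  nlinarith [mul_nonneg hR0 hη]

theorem IsPolyProj.sqrt_dgInnerP_sub_le {pt : ℕ → ℝ} {h : ℝ} (hh : 0 < h)
    (hpt : ∀ j, pt (j + 1) = pt j + h) {N : ℕ} (hN : h * N = 1) {k : ℕ} {P U : ℕ → Polynomial ℝ}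
    {f : ℝ → ℝ} (hP : IsPolyProj pt N k f P) (hUdeg : DegLe k N U) (hf : Continuous f) {η : ℝ}
    (hη : 0 ≤ η) (hU : ∀ j < N, ∀ x ∈ Set.Icc (pt j) (pt j + h), |(U j).eval x - f x| ≤ η) :
    √(dgInnerP pt N (P - U) (P - U)) ≤ η := by
  have h1 := hP.2 (P - U) fun j hj =>
    (Polynomial.degree_sub_le _ _).trans (max_le (hP.1 j hj) (hUdeg j hj))
  have h2 : dgInnerP pt N (P - U) (P - U)
      = ∑ j ∈ Finset.range N, ∫ x in (pt j)..(pt (j + 1)),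
        (f x - (U j).eval x) * ((P - U) j).eval x := by
    have e1 : dgInnerP pt N (P - U) (P - U)
        = dgInnerP pt N P (P - U) - dgInnerP pt N U (P - U) := by
      unfold dgInnerP
      rw [← Finset.sum_sub_distrib]
      refine Finset.sum_congr rfl fun j _ => ?_
      rw [← intervalIntegral.integral_sub ((by fun_prop : Continuous _).intervalIntegrable _ _)
        ((by fun_prop : Continuous _).intervalIntegrable _ _)]
      simp [sub_mul]
    rw [e1, ← h1]
    unfold dgInnerP dgInnerF
    rw [← Finset.sum_sub_distrib]
    refine Finset.sum_congr rfl fun j _ => ?_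
    rw [← intervalIntegral.integral_sub ((by fun_prop : Continuous _).intervalIntegrable _ _)
      ((by fun_prop : Continuous _).intervalIntegrable _ _)]
    simp [sub_mul]
  have h3 := sum_integral_le_of_le hh hpt hN
    (F := fun j x => (f x - (U j).eval x) * ((P - U) j).eval x)
    (G := fun j x => ((P - U) j).eval x * ((P - U) j).eval x) (r := 1 / 2) (s := 1 / 2 * η ^ 2)
    (fun j => by fun_prop) (fun j => by fun_prop)
    (fun j hj x hx => by
      have h1 := sq_le_sq.2 ((hU j hj x hx).trans (le_abs_self η))
      nlinarith [sq_nonneg (f x - (U j).eval x - ((P - U) j).eval x)])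
  rw [← h2] at h3
  change _ ≤ 1 / 2 * dgInnerP pt N (P - U) (P - U) + _ at h3
  exact Real.sqrt_le_iff.2 ⟨hη, by linarith⟩

/-- The piecewise linear interpolant of a function on the uniform mesh. -/
noncomputable def uniInterp (N : ℕ) (G : ℝ → ℝ) (j : ℕ) : Polynomial ℝ :=
  linInterp (uniPt N j) (1 / N) (G (uniPt N j)) (G (uniPt N (j + 1)))

/-- The slope of the piecewise linear interpolant of a function on the uniform mesh. -/
noncomputable def uniSlope (N : ℕ) (G : ℝ → ℝ) (j : ℕ) : ℝ :=
  (G (uniPt N (j + 1)) - G (uniPt N j)) / (1 / N)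

theorem dgInnerP_uniSlope (c dt : ℝ) {N : ℕ} {g : ℝ → ℝ} (hg : Function.Periodic g 1)
    (t : ℝ) (Q : ℕ → Polynomial ℝ) :
    dgInnerP (uniPt N) N
        (fun j => Polynomial.C (-(c * dt) * uniSlope N (fun x => g (x - t)) j)) Q
      = dt * dgH c (uniPt N) N (uniInterp N fun x => g (x - t)) Q := by
  rw [dgH_eq_strong, Finset.mul_sum]
  refine Finset.sum_congr rfl fun j hj => ?_
  have hj := Finset.mem_range.1 hj
  have hN : (1 / (N : ℝ)) ≠ 0 := by
    have : 0 < N := by omega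
    positivity
  have e1 : (uniInterp N (fun x => g (x - t)) (prevCell N j)).eval (uniPt N (prevCell N j + 1))
      = g (uniPt N j - t) := by
    rw [← hg.uniPt_prevCell t hj]
    unfold uniInterp
    conv_lhs => rw [uniPt_succ N (prevCell N j)]
    rw [linInterp_eval_right hN, ← uniPt_succ]
  rw [e1]
  unfold uniInterp
  rw [linInterp_eval_left, linInterp_derivative, sub_self, zero_mul, add_zero]
  simp only [Polynomial.eval_C, intervalIntegral.integral_const_mul]
  unfold uniSlope
  ring

theorem abs_uniSlope_sub_le {N : ℕ} (hN : 0 < N) {g D : ℝ → ℝ} {M : ℝ}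
    (hM : ∀ x a, |g (x + a) - g x - a * D x| ≤ M * a ^ 2) (t : ℝ) (j : ℕ) :
    |uniSlope N (fun x => g (x - t)) j - D (uniPt N j - t)| ≤ M * (1 / N) ∧
    |uniSlope N (fun x => g (x - t)) j - D (uniPt N (j + 1) - t)| ≤ M * (1 / N) := by
  have hh : 0 < 1 / (N : ℝ) := by positivity
  unfold uniSlope
  constructor
  · have h1 := hM (uniPt N j - t) (1 / N)
    rw [sub_add_eq_add_sub, ← uniPt_succ] at h1
    set h := 1 / (N : ℝ)
    have e : (g (uniPt N (j + 1) - t) - g (uniPt N j - t)) / h - D (uniPt N j - t)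
        = (g (uniPt N (j + 1) - t) - g (uniPt N j - t) - h * D (uniPt N j - t)) / h := by
      field_simp
    simp only [e]
    rw [abs_div, abs_of_pos hh, div_le_iff₀ hh]
    linarith
  · have h1 := hM (uniPt N (j + 1) - t) (-(1 / N))
    have e0 : uniPt N (j + 1) - t + -(1 / (N : ℝ)) = uniPt N j - t := by
      rw [uniPt_succ]; ring
    rw [e0] at h1
    set h := 1 / (N : ℝ)
    have e : (g (uniPt N (j + 1) - t) - g (uniPt N j - t)) / h - D (uniPt N (j + 1) - t)
        = -(g (uniPt N j - t) - g (uniPt N (j + 1) - t) - -h * D (uniPt N (j + 1) - t)) / h := by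
      field_simp
      ring
    simp only [e]
    rw [abs_div, abs_neg, abs_of_pos hh, div_le_iff₀ hh]
    linarith

theorem abs_uniInterp_step_le {N : ℕ} (hN : 0 < N) {g D : ℝ → ℝ} {M : ℝ}
    (hM : ∀ x a, |g (x + a) - g x - a * D x| ≤ M * a ^ 2) {τ : ℝ} (hτ : 0 ≤ τ) (t : ℝ) (j : ℕ)
    {x : ℝ} (hx : x ∈ Set.Icc (uniPt N j) (uniPt N j + 1 / N)) :
    |(uniInterp N (fun x => g (x - (t + τ))) j - uniInterp N (fun x => g (x - t)) j
      - Polynomial.C (-τ * uniSlope N (fun x => g (x - t)) j)).eval x|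
      ≤ M * τ * (τ + 1 / N) := by
  have hh : 0 < 1 / (N : ℝ) := by positivity
  have hend : ∀ y σ, |σ - D (y - t)| ≤ M * (1 / N) →
      |g (y - (t + τ)) - g (y - t) + τ * σ - 0| ≤ M * τ * (τ + 1 / N) := by
    intro y σ hσ
    have h1 := hM (y - t) (-τ)
    rw [show y - t + -τ = y - (t + τ) by ring] at h1
    have e : g (y - (t + τ)) - g (y - t) + τ * σ - 0
        = (g (y - (t + τ)) - g (y - t) - -τ * D (y - t)) + τ * (σ - D (y - t)) := by ring
    rw [e]
    refine (abs_add_le _ _).trans ?_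
    rw [abs_mul, abs_of_nonneg hτ]
    have := mul_le_mul_of_nonneg_left hσ hτ
    linarith
  obtain ⟨s1, s2⟩ := abs_uniSlope_sub_le hN hM t j
  have := abs_linInterp_sub_le hh hx (hend _ _ s1) (hend _ _ s2)
  convert this using 2
  simp only [uniInterp, linInterp_eval, Polynomial.eval_sub, Polynomial.eval_C]
  ring

theorem dg_rk3_rate (k : ℕ) (L c T : ℝ) (hk : 1 ≤ k) (hL : 0 ≤ L) (hc : 0 < c) (hT : 0 < T) :
    ∃ C0 > (0 : ℝ), ∃ C1, 0 ≤ C1 ∧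
      ∀ v0 : ℝ → ℝ, Function.Periodic v0 1 → (∀ x y, |v0 x - v0 y| ≤ L * |x - y|) →
      ∀ N : ℕ, 0 < N → ∀ dt : ℝ, 0 < dt → dt ≤ C0 * (1 / (N : ℝ)) →
      ∀ v : ℕ → ℕ → Polynomial ℝ,
        (∀ n, DegLe k N (v n)) →
        IsPolyProj (uniPt N) N k v0 (v 0) →
        (∀ n, IsRK3Step c dt (uniPt N) N k (v n) (v (n + 1))) →
        ∀ n : ℕ, (n : ℝ) * dt ≤ T →
          dgErr (uniPt N) N (v n) (fun x => v0 (x - c * ((n : ℝ) * dt)))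
            ≤ C1 * √(1 / (N : ℝ)) := by
  obtain ⟨K, hK, hinv⟩ := exists_inverse_estimate k
  set C0 := 1 / (3 * c * K + 1) with hC0
  have hC0pos : 0 < C0 := by positivity
  set E := 2 * c ^ 2 * √K * C0 + c ^ 2 * C0 + c with hE
  have hE0 : 0 ≤ E := by positivity
  refine ⟨C0, hC0pos, 2 * (2 * L + 4 * T * L * E) + 4 * L, by positivity, ?_⟩
  intro v0 hper hlip N hN dt hdt hcfl v hv hproj hstep n hn
  have hcont : Continuous v0 := (LipschitzWith.of_dist_le_mul (K := ⟨L, hL⟩) hlip).continuous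
  have hpt := uniPt_succ N
  have hh : 0 < 1 / (N : ℝ) := by positivity
  have hN1 : 1 / (N : ℝ) * N = 1 := by field_simp
  have hh1 : 1 / (N : ℝ) ≤ 1 := by
    rw [div_le_one (by positivity)]; exact_mod_cast hN
  have hinvh := hinv _ hh
  obtain ⟨g, D, hg, hD, hgv, hM⟩ := exists_steklov_average hper hL hlip (Real.sqrt_pos.2 hh)
  set h : ℝ := 1 / (N : ℝ) with hhdef
  set δ := √h with hδ
  have hδ0 : 0 < δ := Real.sqrt_pos.2 hh
  have hδ2 : δ ^ 2 = h := Real.sq_sqrt hh.le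
  have hδ1 : h ≤ δ := by nlinarith [Real.sqrt_le_one.2 hh1]
  set M := 2 * L / δ with hMdef
  have hM0 : 0 ≤ M := by positivity
  have hMh : M * h = 2 * L * δ := by rw [hMdef, ← hδ2]; field_simp
  set U : ℕ → ℕ → Polynomial ℝ := fun n => uniInterp N fun x => g (x - n * (c * dt)) with hUdef
  set W : ℕ → ℕ → Polynomial ℝ := fun n j =>
    Polynomial.C (-(c * dt) * uniSlope N (fun x => g (x - n * (c * dt))) j) with hWdef
  have hUdeg : ∀ n, DegLe k N (U n) := fun n j _ =>
    (linInterp_degree_le _ _ _ _).trans (by exact_mod_cast hk)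
  have hWdeg : ∀ n, DegLe k N (W n) := fun n j _ =>
    Polynomial.degree_C_le.trans (by exact_mod_cast Nat.zero_le k)
  have hcdt : 0 ≤ c * dt := by positivity
  have hUv : ∀ n : ℕ, ∀ j < N, ∀ x ∈ Set.Icc (uniPt N j) (uniPt N j + h),
      |(U n j).eval x - v0 (x - c * (n * dt))| ≤ 2 * L * δ := by
    intro n j _ x hx
    have hnode : ∀ y, |y - x| ≤ h →
        |g (y - n * (c * dt)) - v0 (x - c * (n * dt))| ≤ 2 * L * δ := by
      intro y hy
      have h1 := hgv (y - n * (c * dt))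
      have h2 := hlip (y - n * (c * dt)) (x - c * (n * dt))
      rw [show y - n * (c * dt) - (x - c * (n * dt)) = y - x by ring] at h2
      have h3 : L * |y - x| ≤ L * δ := mul_le_mul_of_nonneg_left (hy.trans hδ1) hL
      have h4 := abs_sub_le (g (y - n * (c * dt))) (v0 (y - n * (c * dt))) (v0 (x - c * (n * dt)))
      linarith
    refine abs_linInterp_sub_le hh hx (hnode _ ?_) (hnode _ ?_)
    · rw [abs_le]; constructor <;> linarith [hx.1, hx.2]
    · rw [hpt, abs_le]; constructor <;> linarith [hx.1, hx.2]
  have hdtε : ∀ A : ℝ, 0 ≤ A → A * dt * (M * dt) ≤ A * C0 * (M * dt * h) := by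
    intro A hA
    calc A * dt * (M * dt) ≤ A * (C0 * h) * (M * dt) := by gcongr
      _ = _ := by ring
  have hmain := dg_rk3_error_le (ε := E * (M * dt * h)) hc.le hdt.le hK hh hpt hinvh
    (by
      calc dt * (3 * c * K / h) ≤ C0 * h * (3 * c * K / h) := by gcongr
        _ = C0 * (3 * c * K) := by field_simp
        _ ≤ 1 := by
          rw [hC0, one_div_mul_eq_div, div_le_one (by positivity)]
          linarith)
    hv hstep hUdeg hWdeg (fun n Q _ => dgInnerP_uniSlope c dt hg _ Q) (by positivity)
    (fun n Q hQ => by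
      have hb := abs_dgH_le_of_piecewise_const hc.le hK hh hpt hinvh hN1
        (s := fun j => -(c * dt) * uniSlope N (fun x => g (x - n * (c * dt))) j)
        (J := c * dt * (2 * (M * h))) (by positivity) (fun j hj => by
          have s1 := (abs_uniSlope_sub_le hN hM (n * (c * dt)) j).1
          have s2 := (abs_uniSlope_sub_le hN hM (n * (c * dt)) (prevCell N j)).2
          rw [hD.uniPt_prevCell _ hj] at s2
          rw [← mul_sub, abs_mul, abs_neg, abs_of_nonneg hcdt]
          gcongr
          rw [abs_sub_comm] at s2
          refine (abs_sub_le _ _ _).trans ((add_le_add s1 s2).trans_eq ?_)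
          ring) hQ
      rw [abs_mul, abs_of_pos hdt]
      calc _ ≤ dt * (c * (c * dt * (2 * (M * h))) * √K / h * √(dgInnerP (uniPt N) N Q Q)) := by
            gcongr
        _ = (2 * c ^ 2 * √K) * dt * (M * dt) * √(dgInnerP (uniPt N) N Q Q) := by
            field_simp
        _ ≤ (2 * c ^ 2 * √K) * C0 * (M * dt * h) * √(dgInnerP (uniPt N) N Q Q) := by
            gcongr ?_ * _
            exact hdtε _ (by positivity)
        _ ≤ _ := by
            gcongr
            rw [hE]
            have : 0 ≤ c ^ 2 * C0 := by positivity
            linarith)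
    (fun n => by
      refine (sqrt_dgInnerP_self_le hh hpt hN1 (η := M * (c * dt) * (c * dt + h)) (by positivity)
        fun j _ x hx => ?_).trans ?_
      · have := abs_uniInterp_step_le hN hM hcdt (n * (c * dt)) j hx
        rw [← add_one_mul, ← Nat.cast_add_one] at this
        exact this
      · have e1 := hdtε (c ^ 2) (by positivity)
        have e2 : 0 ≤ 2 * c ^ 2 * √K * C0 * (M * dt * h) := by positivity
        rw [hE]
        linarith) n
  have hinit : √(dgInnerP (uniPt N) N (v 0 - U 0) (v 0 - U 0)) ≤ 2 * L * δ :=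
    hproj.sqrt_dgInnerP_sub_le hh hpt hN1 (hUdeg 0) hcont (by positivity)
      (fun j hj x hx => by simpa using hUv 0 j hj x hx)
  have hfin := dgErr_le hh hpt hN1 (P := v n) (f := fun x => v0 (x - c * (n * dt)))
    (by fun_prop) (by positivity) (hUv n)
  have hacc : n * (2 * (E * (M * dt * h))) ≤ 4 * T * L * E * δ := by
    calc n * (2 * (E * (M * dt * h))) = (n * dt) * (2 * E * (M * h)) := by ring
      _ ≤ T * (2 * E * (M * h)) := by gcongr
      _ = _ := by rw [hMh]; ring
  calc _ ≤ _ := hfin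
    _ ≤ 2 * (2 * L * δ + 4 * T * L * E * δ) + 2 * (2 * L * δ) := by linarith
    _ = _ := by ring

/-- Theorem 5.3 of the paper: fully discrete error estimate for the TVD-RK3 DG scheme
for `v_t + c v_x = 0` with `1`-periodic `v₀ ∈ C^{ℓ+1}_{p,L,c₀}`, `k ≥ 1`, `ℓ ≥ 2`,
under the CFL condition `Δt ≤ C₀ h` (`h = 1/N`):
`‖v_h^n - v₀(· - c nΔt)‖_{L²(0,1)} ≤ C₁ (h + h³/Δt²)^{1/2}` for `nΔt ≤ T`; and if
moreover `Δt/h ≥ C̄₀ > 0` then `‖v_h^n - v₀(· - c nΔt)‖_{L²(0,1)} ≤ C₁' h^{1/2}`. -/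
theorem stmt16 (k l p : ℕ) (L c0 c T : ℝ)
    (hk : 1 ≤ k) (hl : 2 ≤ l) (hL : 0 ≤ L) (hc0 : 0 ≤ c0) (hc : 0 < c) (hT : 0 < T) :
    (∃ C0 > (0:ℝ), ∃ C1, 0 ≤ C1 ∧
      ∀ v0 : ℝ → ℝ, PeriodicClass l p L c0 v0 →
      ∀ N : ℕ, 0 < N → ∀ dt : ℝ, 0 < dt → dt ≤ C0 * (1 / (N : ℝ)) →
      ∀ v : ℕ → ℕ → Polynomial ℝ,
        (∀ n, DegLe k N (v n)) →
        IsPolyProj (uniPt N) N k v0 (v 0) →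
        (∀ n, IsRK3Step c dt (uniPt N) N k (v n) (v (n + 1))) →
        ∀ n : ℕ, (n : ℝ) * dt ≤ T →
          dgErr (uniPt N) N (v n) (fun x => v0 (x - c * ((n : ℝ) * dt)))
            ≤ C1 * Real.sqrt (1 / (N : ℝ) + (1 / (N : ℝ)) ^ 3 / dt ^ 2)) ∧
    (∀ Cb : ℝ, 0 < Cb →
      ∃ C0 > (0:ℝ), ∃ C1', 0 ≤ C1' ∧
      ∀ v0 : ℝ → ℝ, PeriodicClass l p L c0 v0 →
      ∀ N : ℕ, 0 < N → ∀ dt : ℝ, 0 < dt → dt ≤ C0 * (1 / (N : ℝ)) →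
        Cb * (1 / (N : ℝ)) ≤ dt →
      ∀ v : ℕ → ℕ → Polynomial ℝ,
        (∀ n, DegLe k N (v n)) →
        IsPolyProj (uniPt N) N k v0 (v 0) →
        (∀ n, IsRK3Step c dt (uniPt N) N k (v n) (v (n + 1))) →
        ∀ n : ℕ, (n : ℝ) * dt ≤ T →
          dgErr (uniPt N) N (v n) (fun x => v0 (x - c * ((n : ℝ) * dt)))
            ≤ C1' * Real.sqrt (1 / (N : ℝ))) := by
  obtain ⟨C0, hC0, C1, hC1, H⟩ := dg_rk3_rate k L c T hk hL hc hT
  refine ⟨⟨C0, hC0, C1, hC1, fun v0 hv0 N hN dt hdt hcfl v hv hp hs n hn => ?_⟩,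
    fun Cb _ => ⟨C0, hC0, C1, hC1, fun v0 hv0 N hN dt hdt hcfl _ v hv hp hs n hn =>
      H v0 hv0.1 hv0.2.1 N hN dt hdt hcfl v hv hp hs n hn⟩⟩
  refine (H v0 hv0.1 hv0.2.1 N hN dt hdt hcfl v hv hp hs n hn).trans ?_
  gcongr
  exact le_add_of_nonneg_right (by positivity)
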